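/- Monotone decreasing convergence of the modified Newton iteration: Assume the sign conditions hold, the kernel condition holds, (A, B) is stabilizable, and (Q − L R⁻¹ Lᵀ, A) is detectable. Suppose X_* ∈ ℝ^{n×n} is symmetric positive semidefinite with 𝓡(X_*) = 0 and is the unique symmetric positive semidefinite solution of 𝓡(X) = 0. Let X_0 be symmetric with X_0 ⪰ X_*, A_c(X_0) − G_c(X_0) X_0 stable, and 𝓡(X_0) ⪯ 0, and let (X_k)_{k≥0} be symmetric n×n matrices such that for every k ≥ 0: A_c(X_k)ᵀ X_{k+1} + X_{k+1} A_c(X_k) − X_{k+1} G_c(X_k) X_{k+1} + H_c(X_k) + (X_{k+1} − X_k) G_c(X_k) (X_{k+1} − X_k) = 0, and assume X_k ⪰ 0 for all k. Then: (a) X_k ⪰ X_{k+1} ⪰ X_* and 𝓡(X_k) ⪯ 0 for every k ≥ 0; (b) X_k converges to X_* as k → ∞. -/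

import Mathlib

open Matrix Filter

noncomputable section

/-- `Π₁₁(X) = Σᵢ (A₀ⁱ)ᵀ X A₀ⁱ`. -/
def Pi11 {n r : ℕ} (A0 : Fin r → Matrix (Fin n) (Fin n) ℝ)
    (X : Matrix (Fin n) (Fin n) ℝ) : Matrix (Fin n) (Fin n) ℝ :=
  ∑ i, (A0 i)ᵀ * X * A0 i

/-- `Π₁₂(X) = Σᵢ (A₀ⁱ)ᵀ X B₀ⁱ`. -/
def Pi12 {n m r : ℕ} (A0 : Fin r → Matrix (Fin n) (Fin n) ℝ)
    (B0 : Fin r → Matrix (Fin n) (Fin m) ℝ)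
    (X : Matrix (Fin n) (Fin n) ℝ) : Matrix (Fin n) (Fin m) ℝ :=
  ∑ i, (A0 i)ᵀ * X * B0 i

/-- `Π₂₂(X) = Σᵢ (B₀ⁱ)ᵀ X B₀ⁱ`. -/
def Pi22 {n m r : ℕ} (B0 : Fin r → Matrix (Fin n) (Fin m) ℝ)
    (X : Matrix (Fin n) (Fin n) ℝ) : Matrix (Fin m) (Fin m) ℝ :=
  ∑ i, (B0 i)ᵀ * X * B0 i

/-- The block matrix `Π(X) = [Π₁₁(X), Π₁₂(X); Π₁₂(X)ᵀ, Π₂₂(X)]`. -/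
def PiBlock {n m r : ℕ} (A0 : Fin r → Matrix (Fin n) (Fin n) ℝ)
    (B0 : Fin r → Matrix (Fin n) (Fin m) ℝ)
    (X : Matrix (Fin n) (Fin n) ℝ) : Matrix (Fin n ⊕ Fin m) (Fin n ⊕ Fin m) ℝ :=
  fromBlocks (Pi11 A0 X) (Pi12 A0 B0 X) (Pi12 A0 B0 X)ᵀ (Pi22 B0 X)

/-- `L_c(X) = L + Π₁₂(X)`. -/
def Lc {n m r : ℕ} (L : Matrix (Fin n) (Fin m) ℝ)
    (A0 : Fin r → Matrix (Fin n) (Fin n) ℝ) (B0 : Fin r → Matrix (Fin n) (Fin m) ℝ)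
    (X : Matrix (Fin n) (Fin n) ℝ) : Matrix (Fin n) (Fin m) ℝ :=
  L + Pi12 A0 B0 X

/-- `R_c(X) = R + Π₂₂(X)`. -/
def Rc {n m r : ℕ} (R : Matrix (Fin m) (Fin m) ℝ)
    (B0 : Fin r → Matrix (Fin n) (Fin m) ℝ)
    (X : Matrix (Fin n) (Fin n) ℝ) : Matrix (Fin m) (Fin m) ℝ :=
  R + Pi22 B0 X

/-- `Q_c(X) = Q + Π₁₁(X)`. -/
def Qc {n r : ℕ} (Q : Matrix (Fin n) (Fin n) ℝ)
    (A0 : Fin r → Matrix (Fin n) (Fin n) ℝ)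
    (X : Matrix (Fin n) (Fin n) ℝ) : Matrix (Fin n) (Fin n) ℝ :=
  Q + Pi11 A0 X

/-- `A_c(X) = A − B R_c(X)⁻¹ L_c(X)ᵀ`. -/
def Ac {n m r : ℕ} (A : Matrix (Fin n) (Fin n) ℝ) (B : Matrix (Fin n) (Fin m) ℝ)
    (L : Matrix (Fin n) (Fin m) ℝ) (R : Matrix (Fin m) (Fin m) ℝ)
    (A0 : Fin r → Matrix (Fin n) (Fin n) ℝ) (B0 : Fin r → Matrix (Fin n) (Fin m) ℝ)
    (X : Matrix (Fin n) (Fin n) ℝ) : Matrix (Fin n) (Fin n) ℝ :=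
  A - B * (Rc R B0 X)⁻¹ * (Lc L A0 B0 X)ᵀ

/-- `G_c(X) = B R_c(X)⁻¹ Bᵀ`. -/
def Gc {n m r : ℕ} (B : Matrix (Fin n) (Fin m) ℝ) (R : Matrix (Fin m) (Fin m) ℝ)
    (B0 : Fin r → Matrix (Fin n) (Fin m) ℝ)
    (X : Matrix (Fin n) (Fin n) ℝ) : Matrix (Fin n) (Fin n) ℝ :=
  B * (Rc R B0 X)⁻¹ * Bᵀ

/-- `H_c(X) = Q_c(X) − L_c(X) R_c(X)⁻¹ L_c(X)ᵀ`. -/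
def Hc {n m r : ℕ} (Q : Matrix (Fin n) (Fin n) ℝ) (L : Matrix (Fin n) (Fin m) ℝ)
    (R : Matrix (Fin m) (Fin m) ℝ)
    (A0 : Fin r → Matrix (Fin n) (Fin n) ℝ) (B0 : Fin r → Matrix (Fin n) (Fin m) ℝ)
    (X : Matrix (Fin n) (Fin n) ℝ) : Matrix (Fin n) (Fin n) ℝ :=
  Qc Q A0 X - Lc L A0 B0 X * (Rc R B0 X)⁻¹ * (Lc L A0 B0 X)ᵀ

/-- The SCARE residual
`𝓡(X) = AᵀX + XA + Q_c(X) − (XB + L_c(X)) R_c(X)⁻¹ (XB + L_c(X))ᵀ`. -/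
def scareRes {n m r : ℕ} (A : Matrix (Fin n) (Fin n) ℝ) (B : Matrix (Fin n) (Fin m) ℝ)
    (Q : Matrix (Fin n) (Fin n) ℝ) (L : Matrix (Fin n) (Fin m) ℝ)
    (R : Matrix (Fin m) (Fin m) ℝ)
    (A0 : Fin r → Matrix (Fin n) (Fin n) ℝ) (B0 : Fin r → Matrix (Fin n) (Fin m) ℝ)
    (X : Matrix (Fin n) (Fin n) ℝ) : Matrix (Fin n) (Fin n) ℝ :=
  Aᵀ * X + X * A + Qc Q A0 X -
    (X * B + Lc L A0 B0 X) * (Rc R B0 X)⁻¹ * (X * B + Lc L A0 B0 X)ᵀ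

/-- `Ω(X) = [−G_c(X), −A_c(X); −A_c(X)ᵀ, H_c(X)]`. -/
def Omega {n m r : ℕ} (A : Matrix (Fin n) (Fin n) ℝ) (B : Matrix (Fin n) (Fin m) ℝ)
    (Q : Matrix (Fin n) (Fin n) ℝ) (L : Matrix (Fin n) (Fin m) ℝ)
    (R : Matrix (Fin m) (Fin m) ℝ)
    (A0 : Fin r → Matrix (Fin n) (Fin n) ℝ) (B0 : Fin r → Matrix (Fin n) (Fin m) ℝ)
    (X : Matrix (Fin n) (Fin n) ℝ) : Matrix (Fin n ⊕ Fin n) (Fin n ⊕ Fin n) ℝ :=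
  fromBlocks (-(Gc B R B0 X)) (-(Ac A B L R A0 B0 X)) (-(Ac A B L R A0 B0 X))ᵀ
    (Hc Q L R A0 B0 X)

/-- The `2n×n` matrix `[X; −Iₙ]` stacking `X` over `−Iₙ`. -/
def stackNegI {n : ℕ} (X : Matrix (Fin n) (Fin n) ℝ) :
    Matrix (Fin n ⊕ Fin n) (Fin n) ℝ :=
  fromRows X (-1)

/-- The pair `(A, B)` is stabilizable: `yᴴ(A − λI) = 0`, `yᴴB = 0`, `Re λ ≥ 0` imply `y = 0`. -/
def Stabilizable {n m : ℕ} (A : Matrix (Fin n) (Fin n) ℝ)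
    (B : Matrix (Fin n) (Fin m) ℝ) : Prop :=
  ∀ (lam : ℂ) (y : Fin n → ℂ), 0 ≤ lam.re →
    vecMul (star y) (A.map Complex.ofReal - lam • 1) = 0 →
    vecMul (star y) (B.map Complex.ofReal) = 0 → y = 0

/-- The pair `(C, A)` is detectable: `(A − λI)z = 0`, `Cz = 0`, `Re λ ≥ 0` imply `z = 0`. -/
def Detectable {p n : ℕ} (C : Matrix (Fin p) (Fin n) ℝ)
    (A : Matrix (Fin n) (Fin n) ℝ) : Prop :=
  ∀ (lam : ℂ) (z : Fin n → ℂ), 0 ≤ lam.re →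
    mulVec (A.map Complex.ofReal - lam • 1) z = 0 →
    mulVec (C.map Complex.ofReal) z = 0 → z = 0

/-- A real square matrix is stable if all its (complex) eigenvalues have negative real part. -/
def IsStableMatrix {n : ℕ} (M : Matrix (Fin n) (Fin n) ℝ) : Prop :=
  ∀ μ ∈ spectrum ℂ (M.map Complex.ofReal), μ.re < 0

/-- Kernel condition: `(Q − LR⁻¹Lᵀ)z = 0` implies `Lᵀz = 0` and `A₀ⁱ z = 0` for all `i`. -/
def KernelCondition {n m r : ℕ} (Q : Matrix (Fin n) (Fin n) ℝ)
    (L : Matrix (Fin n) (Fin m) ℝ) (R : Matrix (Fin m) (Fin m) ℝ)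
    (A0 : Fin r → Matrix (Fin n) (Fin n) ℝ) : Prop :=
  ∀ z : Fin n → ℂ,
    mulVec ((Q - L * R⁻¹ * Lᵀ).map Complex.ofReal) z = 0 →
    mulVec (Lᵀ.map Complex.ofReal) z = 0 ∧
      ∀ i, mulVec ((A0 i).map Complex.ofReal) z = 0

/-- `Γ(X) = [[0, −A, −B], [−Aᵀ, Q_c(X), L_c(X)], [−Bᵀ, L_c(X)ᵀ, R_c(X)]]`. -/
def Gamma {n m r : ℕ} (A : Matrix (Fin n) (Fin n) ℝ) (B : Matrix (Fin n) (Fin m) ℝ)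
    (Q : Matrix (Fin n) (Fin n) ℝ) (L : Matrix (Fin n) (Fin m) ℝ)
    (R : Matrix (Fin m) (Fin m) ℝ)
    (A0 : Fin r → Matrix (Fin n) (Fin n) ℝ) (B0 : Fin r → Matrix (Fin n) (Fin m) ℝ)
    (X : Matrix (Fin n) (Fin n) ℝ) :
    Matrix ((Fin n ⊕ Fin n) ⊕ Fin m) ((Fin n ⊕ Fin n) ⊕ Fin m) ℝ :=
  fromBlocks (fromBlocks 0 (-A) (-Aᵀ) (Qc Q A0 X))
    (fromRows (-B) (Lc L A0 B0 X))
    (fromRows (-B) (Lc L A0 B0 X))ᵀ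
    (Rc R B0 X)

/-- `F_W(Y) = [Y; −Iₙ]ᵀ (Ω(Y) − Ω(W)) [Y; −Iₙ]`. -/
def FW {n m r : ℕ} (A : Matrix (Fin n) (Fin n) ℝ) (B : Matrix (Fin n) (Fin m) ℝ)
    (Q : Matrix (Fin n) (Fin n) ℝ) (L : Matrix (Fin n) (Fin m) ℝ)
    (R : Matrix (Fin m) (Fin m) ℝ)
    (A0 : Fin r → Matrix (Fin n) (Fin n) ℝ) (B0 : Fin r → Matrix (Fin n) (Fin m) ℝ)
    (W Y : Matrix (Fin n) (Fin n) ℝ) : Matrix (Fin n) (Fin n) ℝ :=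
  (stackNegI Y)ᵀ * (Omega A B Q L R A0 B0 Y - Omega A B Q L R A0 B0 W) * stackNegI Y

/-- `𝓕_W(Z) = Kᵀ Π(Z) K` with `K = [−Iₙ; R_c(W)⁻¹ (L_c(W) + W B)ᵀ]`. -/
def Fcal {n m r : ℕ} (B : Matrix (Fin n) (Fin m) ℝ)
    (L : Matrix (Fin n) (Fin m) ℝ) (R : Matrix (Fin m) (Fin m) ℝ)
    (A0 : Fin r → Matrix (Fin n) (Fin n) ℝ) (B0 : Fin r → Matrix (Fin n) (Fin m) ℝ)
    (W Z : Matrix (Fin n) (Fin n) ℝ) : Matrix (Fin n) (Fin n) ℝ :=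
  (fromRows (-1 : Matrix (Fin n) (Fin n) ℝ)
      ((Rc R B0 W)⁻¹ * (Lc L A0 B0 W + W * B)ᵀ))ᵀ *
    PiBlock A0 B0 Z *
    fromRows (-1 : Matrix (Fin n) (Fin n) ℝ)
      ((Rc R B0 W)⁻¹ * (Lc L A0 B0 W + W * B)ᵀ)
section helpers

open scoped ComplexOrder Topology ENNReal NNReal

lemma aux_tendsto_pow_zero {E : Type*} [NormedRing E] [NormedAlgebra ℂ E] [CompleteSpace E]
    [Nontrivial E] (a : E) (h : ∀ z ∈ spectrum ℂ a, ‖z‖ < 1) :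
    Tendsto (fun k : ℕ => a ^ k) atTop (𝓝 0) := by
  have h1 : spectralRadius ℂ a < (1 : ℝ≥0) :=
    spectrum.spectralRadius_lt_of_forall_lt a (fun z hz => by
      rw [← NNReal.coe_lt_coe]; simpa using h z hz)
  obtain ⟨c, hc1, hc2⟩ := ENNReal.lt_iff_exists_nnreal_btwn.1 h1
  have hc2' : c < 1 := by exact_mod_cast hc2
  have h2 := (spectrum.pow_nnnorm_pow_one_div_tendsto_nhds_spectralRadius a).eventually_lt_const hc1
  refine squeeze_zero_norm' (a := fun k : ℕ => (c : ℝ) ^ k) ?_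
    (tendsto_pow_atTop_nhds_zero_of_lt_one c.2 (by exact_mod_cast hc2'))
  filter_upwards [h2, eventually_gt_atTop 0] with k hk hk0
  have hk' : (0 : ℝ) < k := by exact_mod_cast hk0
  have h3 := ENNReal.rpow_le_rpow hk.le hk'.le
  rw [← ENNReal.rpow_mul, one_div, inv_mul_cancel₀ hk'.ne', ENNReal.rpow_one,
    ENNReal.rpow_natCast] at h3
  have h4 : ‖a ^ k‖₊ ≤ c ^ k := by exact_mod_cast h3
  exact_mod_cast h4

lemma aux_mem_spectrum {n : ℕ} (M : Matrix (Fin n) (Fin n) ℂ) (μ : ℂ) :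
    μ ∈ spectrum ℂ M ↔ ∃ v, v ≠ 0 ∧ M *ᵥ v = μ • v := by
  rw [spectrum.mem_iff, Matrix.isUnit_iff_isUnit_det, isUnit_iff_ne_zero, not_not,
    ← Matrix.exists_mulVec_eq_zero_iff]
  refine exists_congr fun v => and_congr_right fun _ => ?_
  rw [Matrix.sub_mulVec, sub_eq_zero, Algebra.algebraMap_eq_smul_one, Matrix.smul_mulVec,
    Matrix.one_mulVec, eq_comm]

lemma aux_matrix_pow {n : ℕ} [NeZero n] (M : Matrix (Fin n) (Fin n) ℂ)
    (h : ∀ z ∈ spectrum ℂ M, ‖z‖ < 1) : Tendsto (fun k : ℕ => M ^ k) atTop (𝓝 0) := by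
  let _ : NormedRing (Matrix (Fin n) (Fin n) ℂ) := Matrix.linftyOpNormedRing
  let _ : NormedAlgebra ℂ (Matrix (Fin n) (Fin n) ℂ) := Matrix.linftyOpNormedAlgebra
  have : CompleteSpace (Matrix (Fin n) (Fin n) ℂ) := FiniteDimensional.complete ℂ _
  exact aux_tendsto_pow_zero M h

lemma aux_lyap {n : ℕ} [NeZero n] (S X : Matrix (Fin n) (Fin n) ℂ)
    (hS : ∀ μ ∈ spectrum ℂ S, μ.re < 0) (hX : X.IsHermitian)
    (hP : (-(Sᴴ * X + X * S)).PosSemidef) : X.PosSemidef := by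
  have hu : IsUnit (1 - S) := by
    have : (1 : ℂ) ∉ spectrum ℂ S := fun h => by
      have := hS 1 h
      norm_num at this
    rw [spectrum.notMem_iff] at this
    simpa using this
  have hdet : IsUnit (1 - S).det := (Matrix.isUnit_iff_isUnit_det _).1 hu
  set N := (1 - S)⁻¹ with hN
  have hN1 : (1 - S) * N = 1 := Matrix.mul_nonsing_inv _ hdet
  have hN2 : N * (1 - S) = 1 := Matrix.nonsing_inv_mul _ hdet
  set C := (1 + S) * N with hC
  have hspec : ∀ z ∈ spectrum ℂ C, ‖z‖ < 1 := by
    intro μ hμ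
    obtain ⟨v, hv0, hv⟩ := (aux_mem_spectrum _ _).1 hμ
    set w := N *ᵥ v with hw
    have hvw : v = (1 - S) *ᵥ w := by rw [hw, Matrix.mulVec_mulVec, hN1, Matrix.one_mulVec]
    have hw0 : w ≠ 0 := by
      intro h; apply hv0; rw [hvw, h, Matrix.mulVec_zero]
    have h1 : (1 + S) *ᵥ w = μ • ((1 - S) *ᵥ w) := by
      rw [← hvw, ← hv, hC, hw, Matrix.mulVec_mulVec]
    have h2 : (1 + μ) • (S *ᵥ w) = (μ - 1) • w := by
      rw [Matrix.add_mulVec, Matrix.sub_mulVec, Matrix.one_mulVec] at h1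
      have h3 : S *ᵥ w = μ • (w - S *ᵥ w) - w := by rw [← h1]; abel
      rw [add_smul, one_smul]
      nth_rewrite 1 [h3]
      rw [smul_sub, sub_smul, one_smul]
      abel
    have hμ1 : 1 + μ ≠ 0 := by
      intro h
      rw [h, zero_smul] at h2
      have h3 : μ - 1 = -2 := by linear_combination h
      rw [h3] at h2
      exact hw0 ((smul_eq_zero.1 h2.symm).resolve_left (by norm_num))
    have h3 : S *ᵥ w = ((μ - 1) / (1 + μ)) • w := by
      rw [div_eq_inv_mul, mul_smul, ← h2, smul_smul, inv_mul_cancel₀ hμ1, one_smul]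
    have h4 := hS _ ((aux_mem_spectrum _ _).2 ⟨w, hw0, h3⟩)
    have h5 : 0 < Complex.normSq (1 + μ) := Complex.normSq_pos.2 hμ1
    rw [Complex.div_re, ← add_div, div_lt_iff₀ h5, zero_mul] at h4
    simp at h4
    have h6 : Complex.normSq μ < 1 := by
      rw [Complex.normSq_apply]; nlinarith
    rw [Complex.normSq_eq_norm_sq] at h6
    nlinarith [norm_nonneg μ]
  have hCt := aux_matrix_pow C hspec
  have hstep : (X - Cᴴ * X * C).PosSemidef := by
    have h1 := (hP.add hP).conjTranspose_mul_mul_same N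
    convert! h1 using 1
    have e1 : X = Nᴴ * ((1 - S)ᴴ * X * (1 - S)) * N := by
      have : Nᴴ * (1 - S)ᴴ = 1 := by
        rw [← Matrix.conjTranspose_mul, hN1, Matrix.conjTranspose_one]
      calc X = (Nᴴ * (1 - S)ᴴ) * X * ((1 - S) * N) := by rw [this, hN1]; simp
        _ = _ := by noncomm_ring
    have e2 : Cᴴ * X * C = Nᴴ * ((1 + S)ᴴ * X * (1 + S)) * N := by
      rw [hC, Matrix.conjTranspose_mul]; noncomm_ring
    conv_lhs => rw [e2]
    conv_lhs => arg 1; rw [e1]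
    simp only [Matrix.conjTranspose_add, Matrix.conjTranspose_sub, Matrix.conjTranspose_one]
    noncomm_ring
  have hpow : ∀ k : ℕ, (X - (C ^ k)ᴴ * X * C ^ k).PosSemidef := by
    intro k
    induction k with
    | zero => simpa using Matrix.PosSemidef.zero
    | succ k ih =>
      have h1 := hstep.add (ih.conjTranspose_mul_mul_same C)
      convert! h1 using 1
      rw [pow_succ, Matrix.conjTranspose_mul]
      noncomm_ring
  refine Matrix.PosSemidef.of_dotProduct_mulVec_nonneg hX fun x => ?_
  have hlim : Tendsto (fun k : ℕ => star x ⬝ᵥ ((X - (C ^ k)ᴴ * X * C ^ k) *ᵥ x)) atTop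
      (𝓝 (star x ⬝ᵥ ((X - (0 : Matrix (Fin n) (Fin n) ℂ)ᴴ * X * 0) *ᵥ x))) := by
    have hc : Continuous fun D : Matrix (Fin n) (Fin n) ℂ =>
        star x ⬝ᵥ ((X - Dᴴ * X * D) *ᵥ x) := by fun_prop
    exact (hc.tendsto 0).comp hCt
  have := ge_of_tendsto' hlim fun k => (hpow k).dotProduct_mulVec_nonneg x
  simpa using this

lemma aux_map_mul {a b c : ℕ} (M : Matrix (Fin a) (Fin b) ℝ) (N : Matrix (Fin b) (Fin c) ℝ) :
    (M * N).map Complex.ofReal = M.map Complex.ofReal * N.map Complex.ofReal := by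
  ext i j; simp [Matrix.mul_apply]

lemma aux_map_add {a b : ℕ} (M N : Matrix (Fin a) (Fin b) ℝ) :
    (M + N).map Complex.ofReal = M.map Complex.ofReal + N.map Complex.ofReal := by
  ext i j; simp

lemma aux_map_sub {a b : ℕ} (M N : Matrix (Fin a) (Fin b) ℝ) :
    (M - N).map Complex.ofReal = M.map Complex.ofReal - N.map Complex.ofReal := by
  ext i j; simp

lemma aux_map_neg {a b : ℕ} (M : Matrix (Fin a) (Fin b) ℝ) :
    (-M).map Complex.ofReal = -M.map Complex.ofReal := by
  ext i j; simp

lemma aux_map_transpose {a b : ℕ} (M : Matrix (Fin a) (Fin b) ℝ) :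
    (Mᵀ).map Complex.ofReal = (M.map Complex.ofReal)ᴴ := by
  ext i j; simp

lemma aux_psd_map {n : ℕ} {P : Matrix (Fin n) (Fin n) ℝ} (hP : P.PosSemidef) :
    (P.map Complex.ofReal).PosSemidef := by
  obtain ⟨D, rfl⟩ : ∃ D : Matrix (Fin n) (Fin n) ℝ, P = Dᵀ * D := by
    open scoped MatrixOrder in
    obtain ⟨D, hD⟩ := CStarAlgebra.nonneg_iff_eq_star_mul_self.mp hP.nonneg
    exact ⟨D, by rw [hD, Matrix.star_eq_conjTranspose,
      Matrix.conjTranspose_eq_transpose_of_trivial]⟩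
  rw [aux_map_mul, aux_map_transpose]
  exact Matrix.posSemidef_conjTranspose_mul_self _

lemma aux_psd_of_map {n : ℕ} {P : Matrix (Fin n) (Fin n) ℝ} (hPs : P.IsHermitian)
    (hP : (P.map Complex.ofReal).PosSemidef) : P.PosSemidef := by
  refine Matrix.PosSemidef.of_dotProduct_mulVec_nonneg hPs fun x => ?_
  have h := hP.dotProduct_mulVec_nonneg (fun i => (x i : ℂ))
  have e : star (fun i => (x i : ℂ)) ⬝ᵥ (P.map Complex.ofReal *ᵥ fun i => (x i : ℂ))
      = ((star x ⬝ᵥ (P *ᵥ x) : ℝ) : ℂ) := by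
    simp [dotProduct, Matrix.mulVec]
  rw [e] at h
  exact_mod_cast h

lemma aux_lyap_real {n : ℕ} (hn : 0 < n) (S X : Matrix (Fin n) (Fin n) ℝ)
    (hS : IsStableMatrix S) (hX : X.IsHermitian)
    (hP : (-(Sᵀ * X + X * S)).PosSemidef) : X.PosSemidef := by
  have : NeZero n := ⟨hn.ne'⟩
  apply aux_psd_of_map hX
  apply aux_lyap (S.map Complex.ofReal) _ hS
  · rw [Matrix.IsHermitian, ← aux_map_transpose, ← Matrix.conjTranspose_eq_transpose_of_trivial,
      hX.eq]
  · have := aux_psd_map hP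
    rwa [aux_map_neg, aux_map_add, aux_map_mul, aux_map_mul, aux_map_transpose] at this

lemma aux_psd_conj {a b : ℕ} {P : Matrix (Fin a) (Fin a) ℝ} (hP : P.PosSemidef)
    (D : Matrix (Fin a) (Fin b) ℝ) : (Dᵀ * P * D).PosSemidef := by
  have := hP.conjTranspose_mul_mul_same D
  rwa [Matrix.conjTranspose_eq_transpose_of_trivial] at this

/-- Sum of two psd matrices annihilating the quadratic form. -/
lemma aux_ker_add {n : ℕ} {P T : Matrix (Fin n) (Fin n) ℂ} (hP : P.PosSemidef)
    (hT : T.PosSemidef) (z : Fin n → ℂ) (h : star z ⬝ᵥ ((P + T) *ᵥ z) = 0) :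
    star z ⬝ᵥ (P *ᵥ z) = 0 ∧ star z ⬝ᵥ (T *ᵥ z) = 0 := by
  rw [Matrix.add_mulVec, dotProduct_add] at h
  exact (add_eq_zero_iff_of_nonneg (hP.dotProduct_mulVec_nonneg z)
    (hT.dotProduct_mulVec_nonneg z)).1 h

/-- The abstract stability lemma. -/
lemma aux_stable {n m : ℕ} (A N X Y : Matrix (Fin n) (Fin n) ℝ) (B L : Matrix (Fin n) (Fin m) ℝ)
    (R : Matrix (Fin m) (Fin m) ℝ) (F : Matrix (Fin m) (Fin n) ℝ)
    (hR : R.PosDef) (hN : N.PosSemidef) (hX : X.PosSemidef) (hY : Y.PosSemidef)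
    (hk : ∀ z : Fin n → ℂ, N.map Complex.ofReal *ᵥ z = 0 → Lᵀ.map Complex.ofReal *ᵥ z = 0)
    (hdet : Detectable N A)
    (heq : (A - B * F)ᵀ * X + X * (A - B * F) +
      (N + ((F - R⁻¹ * Lᵀ)ᵀ * R * (F - R⁻¹ * Lᵀ) + Y)) = 0) :
    IsStableMatrix (A - B * F) := by
  intro μ hμ
  by_contra hre
  push Not at hre
  obtain ⟨z, hz0, hz⟩ := (aux_mem_spectrum _ _).1 hμ
  set S := (A - B * F).map Complex.ofReal with hS
  set E := F - R⁻¹ * Lᵀ with hE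
  have hXc := aux_psd_map hX
  have hYc := aux_psd_map hY
  have hNc := aux_psd_map hN
  have hTc := aux_psd_map (aux_psd_conj hR.posSemidef E)
  have heq' := congrArg (fun M : Matrix (Fin n) (Fin n) ℝ => M.map Complex.ofReal) heq
  simp only [aux_map_add] at heq'
  rw [aux_map_mul, aux_map_transpose, aux_map_mul, ← hS] at heq'
  set Xc := X.map Complex.ofReal
  set W := N.map Complex.ofReal + ((Eᵀ * R * E).map Complex.ofReal + Y.map Complex.ofReal) with hW
  have hWc : W.PosSemidef := hNc.add (hTc.add hYc)
  have h1 : star z ⬝ᵥ ((Sᴴ * Xc + Xc * S + W) *ᵥ z) = 0 := by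
    rw [heq']; simp
  have h2 : star z ⬝ᵥ ((Sᴴ * Xc) *ᵥ z) = star μ * (star z ⬝ᵥ (Xc *ᵥ z)) := by
    rw [← Matrix.mulVec_mulVec, Matrix.dotProduct_mulVec, ← Matrix.star_mulVec, hz, star_smul,
      smul_dotProduct, smul_eq_mul]
  have h3 : star z ⬝ᵥ ((Xc * S) *ᵥ z) = μ * (star z ⬝ᵥ (Xc *ᵥ z)) := by
    rw [← Matrix.mulVec_mulVec, hz, Matrix.mulVec_smul, dotProduct_smul, smul_eq_mul]
  have hx := hXc.dotProduct_mulVec_nonneg z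
  have hw := hWc.dotProduct_mulVec_nonneg z
  rw [Matrix.add_mulVec, Matrix.add_mulVec, dotProduct_add, dotProduct_add, h2, h3, ← add_mul] at h1
  have h4 : 0 ≤ star μ + μ := by
    rw [Complex.le_def]
    simp [hre]
  have h5 := ((add_eq_zero_iff_of_nonneg (mul_nonneg h4 hx) hw).1 h1).2
  obtain ⟨h6, h7⟩ := aux_ker_add hNc (hTc.add hYc) z h5
  obtain ⟨h8, _⟩ := aux_ker_add hTc hYc z h7
  have hNz := (hNc.dotProduct_mulVec_zero_iff z).1 h6
  have hLz := hk z hNz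
  have hEz : E.map Complex.ofReal *ᵥ z = 0 := by
    have hRc := aux_psd_map hR.posSemidef
    have h9 : star (E.map Complex.ofReal *ᵥ z) ⬝ᵥ (R.map Complex.ofReal *ᵥ
        (E.map Complex.ofReal *ᵥ z)) = 0 := by
      rw [← h8, aux_map_mul, aux_map_mul, aux_map_transpose, Matrix.star_mulVec,
        Matrix.mul_assoc, ← Matrix.mulVec_mulVec, ← Matrix.mulVec_mulVec,
        Matrix.dotProduct_mulVec (star z)]
    have h10 := (hRc.dotProduct_mulVec_zero_iff _).1 h9
    have h11 : R⁻¹.map Complex.ofReal * R.map Complex.ofReal = 1 := by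
      rw [← aux_map_mul, Matrix.nonsing_inv_mul _ ((Matrix.isUnit_iff_isUnit_det _).1 hR.isUnit)]
      ext i j; simp [Matrix.one_apply]; split_ifs <;> simp
    have h12 := congrArg (fun v => R⁻¹.map Complex.ofReal *ᵥ v) h10
    simpa only [Matrix.mulVec_mulVec, ← Matrix.mul_assoc, h11, Matrix.one_mul, Matrix.mulVec_zero]
      using h12
  have hFz : F.map Complex.ofReal *ᵥ z = 0 := by
    rw [hE, aux_map_sub, aux_map_mul, Matrix.sub_mulVec, ← Matrix.mulVec_mulVec, hLz,
      Matrix.mulVec_zero, sub_zero] at hEz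
    exact hEz
  apply hz0
  refine hdet μ z hre ?_ hNz
  rw [hS, aux_map_sub, aux_map_mul, Matrix.sub_mulVec, ← Matrix.mulVec_mulVec, hFz,
    Matrix.mulVec_zero, sub_zero] at hz
  rw [Matrix.sub_mulVec, hz, Matrix.smul_mulVec, Matrix.one_mulVec, sub_self]

/-- Monotone bounded sequences of symmetric matrices converge. -/
lemma aux_monotone {n : ℕ} (X : ℕ → Matrix (Fin n) (Fin n) ℝ)
    (hX : ∀ k, (X k).PosSemidef) (hmono : ∀ k, (X k - X (k + 1)).PosSemidef) :
    ∃ Y, Tendsto X atTop (𝓝 Y) := by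
  have hq : ∀ x : Fin n → ℝ, ∃ l, Tendsto (fun k => x ⬝ᵥ (X k *ᵥ x)) atTop (𝓝 l) := by
    intro x
    refine ⟨_, tendsto_atTop_ciInf (antitone_nat_of_succ_le fun k => ?_) ⟨0, ?_⟩⟩
    · have := (hmono k).dotProduct_mulVec_nonneg x
      rw [Matrix.sub_mulVec, dotProduct_sub] at this
      simpa using this
    · rintro _ ⟨k, rfl⟩
      simpa using (hX k).dotProduct_mulVec_nonneg x
  choose l hl using hq
  have hent : ∀ k i j, X k i j = ((Pi.single i 1 + Pi.single j 1) ⬝ᵥ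
      (X k *ᵥ (Pi.single i 1 + Pi.single j 1)) - (Pi.single i 1) ⬝ᵥ (X k *ᵥ (Pi.single i 1))
      - (Pi.single j 1) ⬝ᵥ (X k *ᵥ (Pi.single j 1))) / 2 := by
    intro k i j
    have hs : X k j i = X k i j := by simpa using (hX k).isHermitian.apply i j
    simp [Matrix.mulVec_add, add_dotProduct, hs]
    ring
  refine ⟨Matrix.of fun i j => (l (Pi.single i 1 + Pi.single j 1) - l (Pi.single i 1)
    - l (Pi.single j 1)) / 2, ?_⟩
  refine tendsto_pi_nhds.2 fun i => tendsto_pi_nhds.2 fun j => ?_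
  simp only [hent, Matrix.of_apply]
  exact (((hl _).sub (hl _)).sub (hl _)).div_const 2

lemma aux_psd_closed {n : ℕ} (X : ℕ → Matrix (Fin n) (Fin n) ℝ) (Y : Matrix (Fin n) (Fin n) ℝ)
    (hX : ∀ k, (X k).PosSemidef) (h : Tendsto X atTop (𝓝 Y)) : Y.PosSemidef := by
  refine Matrix.PosSemidef.of_dotProduct_mulVec_nonneg ?_ fun x => ?_
  · have h1 : Tendsto (fun k => (X k)ᴴ) atTop (𝓝 Yᴴ) :=
      ((continuous_id.matrix_conjTranspose).tendsto Y).comp h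
    have h2 : (fun k => (X k)ᴴ) = X := funext fun k => (hX k).isHermitian.eq
    rw [h2] at h1
    exact tendsto_nhds_unique h1 h
  · have hc : Continuous fun D : Matrix (Fin n) (Fin n) ℝ => star x ⬝ᵥ (D *ᵥ x) := by fun_prop
    exact ge_of_tendsto' ((hc.tendsto Y).comp h) fun k => (hX k).dotProduct_mulVec_nonneg x

lemma aux_alg_res {n m : ℕ} (A X Q : Matrix (Fin n) (Fin n) ℝ) (B L : Matrix (Fin n) (Fin m) ℝ)
    (R U : Matrix (Fin m) (Fin m) ℝ) (F : Matrix (Fin m) (Fin n) ℝ) (hX : Xᵀ = X) (hU : Uᵀ = U)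
    (h1 : U * R = 1) (h2 : R * U = 1) :
    Aᵀ * X + X * A + Q - (X * B + L) * U * (X * B + L)ᵀ =
      (A - B * F)ᵀ * X + X * (A - B * F) + (Q - L * F - Fᵀ * Lᵀ + Fᵀ * R * F) -
      (F - U * (X * B + L)ᵀ)ᵀ * R * (F - U * (X * B + L)ᵀ) := by
  have h1' : ∀ M : Matrix (Fin m) (Fin n) ℝ, U * (R * M) = M := fun M => by
    rw [← Matrix.mul_assoc, h1, Matrix.one_mul]
  have h2' : ∀ M : Matrix (Fin m) (Fin n) ℝ, R * (U * M) = M := fun M => by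
    rw [← Matrix.mul_assoc, h2, Matrix.one_mul]
  simp only [Matrix.transpose_sub, Matrix.transpose_add, Matrix.transpose_mul, hX, hU,
    Matrix.transpose_transpose, Matrix.mul_add, Matrix.add_mul, Matrix.mul_sub, Matrix.sub_mul,
    Matrix.mul_assoc, h1', h2']
  abel

lemma aux_alg_iter {n m : ℕ} (A X Y Q : Matrix (Fin n) (Fin n) ℝ) (B L : Matrix (Fin n) (Fin m) ℝ)
    (R U : Matrix (Fin m) (Fin m) ℝ) (F : Matrix (Fin m) (Fin n) ℝ) (hX : Xᵀ = X) (hU : Uᵀ = U)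
    (h1 : U * R = 1) (hF : F = U * (X * B + L)ᵀ) :
    (A - B * U * Lᵀ)ᵀ * Y + Y * (A - B * U * Lᵀ) - Y * (B * U * Bᵀ) * Y + (Q - L * U * Lᵀ) +
        (Y - X) * (B * U * Bᵀ) * (Y - X) =
      (A - B * F)ᵀ * Y + Y * (A - B * F) + (Q - L * F - Fᵀ * Lᵀ + Fᵀ * R * F) := by
  have h1' : ∀ M : Matrix (Fin m) (Fin n) ℝ, U * (R * M) = M := fun M => by
    rw [← Matrix.mul_assoc, h1, Matrix.one_mul]
  simp only [hF, Matrix.transpose_sub, Matrix.transpose_add, Matrix.transpose_mul, hX, hU,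
    Matrix.transpose_transpose, Matrix.mul_add, Matrix.add_mul, Matrix.mul_sub, Matrix.sub_mul,
    Matrix.mul_assoc, h1']
  abel

/-- `Σᵢ (A₀ⁱ - B₀ⁱ F)ᵀ X (A₀ⁱ - B₀ⁱ F)`. -/
def auxPi {n m r : ℕ} (A0 : Fin r → Matrix (Fin n) (Fin n) ℝ)
    (B0 : Fin r → Matrix (Fin n) (Fin m) ℝ) (F : Matrix (Fin m) (Fin n) ℝ)
    (X : Matrix (Fin n) (Fin n) ℝ) : Matrix (Fin n) (Fin n) ℝ :=
  ∑ i, (A0 i - B0 i * F)ᵀ * X * (A0 i - B0 i * F)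

lemma auxPi_eq {n m r : ℕ} (A0 : Fin r → Matrix (Fin n) (Fin n) ℝ)
    (B0 : Fin r → Matrix (Fin n) (Fin m) ℝ) (F : Matrix (Fin m) (Fin n) ℝ)
    (X : Matrix (Fin n) (Fin n) ℝ) (hX : Xᵀ = X) :
    auxPi A0 B0 F X = Pi11 A0 X - Pi12 A0 B0 X * F - Fᵀ * (Pi12 A0 B0 X)ᵀ +
      Fᵀ * Pi22 B0 X * F := by
  simp only [auxPi, Pi11, Pi12, Pi22, Matrix.transpose_sum, Matrix.sum_mul, Matrix.mul_sum,
    ← Finset.sum_sub_distrib, ← Finset.sum_add_distrib]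
  refine Finset.sum_congr rfl fun i _ => ?_
  simp only [Matrix.transpose_sub, Matrix.transpose_mul, hX,
    Matrix.transpose_transpose, Matrix.mul_sub, Matrix.sub_mul, Matrix.mul_assoc]
  abel

lemma auxPi_sub {n m r : ℕ} (A0 : Fin r → Matrix (Fin n) (Fin n) ℝ)
    (B0 : Fin r → Matrix (Fin n) (Fin m) ℝ) (F : Matrix (Fin m) (Fin n) ℝ)
    (X Y : Matrix (Fin n) (Fin n) ℝ) :
    auxPi A0 B0 F (X - Y) = auxPi A0 B0 F X - auxPi A0 B0 F Y := by
  simp only [auxPi, ← Finset.sum_sub_distrib]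
  refine Finset.sum_congr rfl fun i _ => ?_
  rw [Matrix.mul_sub _ X Y, Matrix.sub_mul]

lemma auxPi_psd {n m r : ℕ} (A0 : Fin r → Matrix (Fin n) (Fin n) ℝ)
    (B0 : Fin r → Matrix (Fin n) (Fin m) ℝ) (F : Matrix (Fin m) (Fin n) ℝ)
    (X : Matrix (Fin n) (Fin n) ℝ) (hX : X.PosSemidef) : (auxPi A0 B0 F X).PosSemidef :=
  Matrix.posSemidef_sum _ fun _ _ => aux_psd_conj hX _

lemma aux_sym {n : ℕ} {X : Matrix (Fin n) (Fin n) ℝ} (h : X.IsHermitian) : Xᵀ = X := by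
  rw [← Matrix.conjTranspose_eq_transpose_of_trivial, h.eq]

lemma aux_alg_T {n m r : ℕ} (X Q : Matrix (Fin n) (Fin n) ℝ) (L : Matrix (Fin n) (Fin m) ℝ)
    (R : Matrix (Fin m) (Fin m) ℝ) (A0 : Fin r → Matrix (Fin n) (Fin n) ℝ)
    (B0 : Fin r → Matrix (Fin n) (Fin m) ℝ) (F : Matrix (Fin m) (Fin n) ℝ)
    (hR : R.PosDef) (hX : Xᵀ = X) :
    Qc Q A0 X - Lc L A0 B0 X * F - Fᵀ * (Lc L A0 B0 X)ᵀ + Fᵀ * Rc R B0 X * F =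
      (Q - L * R⁻¹ * Lᵀ) + ((F - R⁻¹ * Lᵀ)ᵀ * R * (F - R⁻¹ * Lᵀ) + auxPi A0 B0 F X) := by
  have hu := (Matrix.isUnit_iff_isUnit_det _).1 hR.isUnit
  have hU : (R⁻¹)ᵀ = R⁻¹ := aux_sym hR.isHermitian.inv
  have h1 := Matrix.nonsing_inv_mul _ hu
  have h2 := Matrix.mul_nonsing_inv _ hu
  have h1' : ∀ M : Matrix (Fin m) (Fin n) ℝ, R⁻¹ * (R * M) = M := fun M => by
    rw [← Matrix.mul_assoc, h1, Matrix.one_mul]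
  have h2' : ∀ M : Matrix (Fin m) (Fin n) ℝ, R * (R⁻¹ * M) = M := fun M => by
    rw [← Matrix.mul_assoc, h2, Matrix.one_mul]
  rw [auxPi_eq _ _ _ _ hX]
  simp only [Qc, Lc, Rc, Matrix.transpose_sub, Matrix.transpose_add, Matrix.transpose_mul, hU,
    Matrix.transpose_transpose, Matrix.mul_add, Matrix.add_mul, Matrix.mul_sub, Matrix.sub_mul,
    Matrix.mul_assoc, h1', h2']
  abel

lemma aux_Rc {n m r : ℕ} {R : Matrix (Fin m) (Fin m) ℝ} (hR : R.PosDef)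
    (B0 : Fin r → Matrix (Fin n) (Fin m) ℝ)
    {X : Matrix (Fin n) (Fin n) ℝ} (hX : X.PosSemidef) : (Rc R B0 X).PosDef :=
  hR.add_posSemidef (Matrix.posSemidef_sum _ fun _ _ => aux_psd_conj hX _)

/-- The feedback gain `R_c(X)⁻¹ (XB + L_c(X))ᵀ`. -/
def auxF {n m r : ℕ} (B L : Matrix (Fin n) (Fin m) ℝ)
    (R : Matrix (Fin m) (Fin m) ℝ) (A0 : Fin r → Matrix (Fin n) (Fin n) ℝ)
    (B0 : Fin r → Matrix (Fin n) (Fin m) ℝ) (X : Matrix (Fin n) (Fin n) ℝ) :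
    Matrix (Fin m) (Fin n) ℝ :=
  (Rc R B0 X)⁻¹ * (X * B + Lc L A0 B0 X)ᵀ

/-- The constant part of the quadratic form. -/
def auxW {n m : ℕ} (Q : Matrix (Fin n) (Fin n) ℝ) (L : Matrix (Fin n) (Fin m) ℝ)
    (R : Matrix (Fin m) (Fin m) ℝ) (F : Matrix (Fin m) (Fin n) ℝ) : Matrix (Fin n) (Fin n) ℝ :=
  (F - R⁻¹ * Lᵀ)ᵀ * R * (F - R⁻¹ * Lᵀ)

lemma aux_res {n m r : ℕ} (A X Q : Matrix (Fin n) (Fin n) ℝ) (B L : Matrix (Fin n) (Fin m) ℝ)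
    (R : Matrix (Fin m) (Fin m) ℝ) (A0 : Fin r → Matrix (Fin n) (Fin n) ℝ)
    (B0 : Fin r → Matrix (Fin n) (Fin m) ℝ) (F : Matrix (Fin m) (Fin n) ℝ)
    (hR : R.PosDef) (hX : X.PosSemidef) :
    scareRes A B Q L R A0 B0 X = (A - B * F)ᵀ * X + X * (A - B * F) +
      ((Q - L * R⁻¹ * Lᵀ) + (auxW Q L R F + auxPi A0 B0 F X)) -
      (F - auxF B L R A0 B0 X)ᵀ * Rc R B0 X * (F - auxF B L R A0 B0 X) := by
  have hRc := aux_Rc hR B0 hX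
  have hu := (Matrix.isUnit_iff_isUnit_det _).1 hRc.isUnit
  rw [auxW, ← aux_alg_T X Q L R A0 B0 F hR (aux_sym hX.isHermitian)]
  exact aux_alg_res A X _ B _ _ _ F (aux_sym hX.isHermitian) (aux_sym hRc.isHermitian.inv)
    (Matrix.nonsing_inv_mul _ hu) (Matrix.mul_nonsing_inv _ hu)

lemma aux_iter {n m r : ℕ} (A X Y Q : Matrix (Fin n) (Fin n) ℝ) (B L : Matrix (Fin n) (Fin m) ℝ)
    (R : Matrix (Fin m) (Fin m) ℝ) (A0 : Fin r → Matrix (Fin n) (Fin n) ℝ)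
    (B0 : Fin r → Matrix (Fin n) (Fin m) ℝ) (F : Matrix (Fin m) (Fin n) ℝ)
    (hR : R.PosDef) (hX : X.PosSemidef) (hF : F = auxF B L R A0 B0 X) :
    (Ac A B L R A0 B0 X)ᵀ * Y + Y * Ac A B L R A0 B0 X -
        Y * Gc B R B0 X * Y + Hc Q L R A0 B0 X + (Y - X) * Gc B R B0 X * (Y - X) =
      (A - B * F)ᵀ * Y + Y * (A - B * F) +
      ((Q - L * R⁻¹ * Lᵀ) + (auxW Q L R F + auxPi A0 B0 F X)) := by
  have hRc := aux_Rc hR B0 hX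
  have hu := (Matrix.isUnit_iff_isUnit_det _).1 hRc.isUnit
  rw [auxW, ← aux_alg_T X Q L R A0 B0 F hR (aux_sym hX.isHermitian)]
  exact aux_alg_iter A X Y _ B _ _ _ F (aux_sym hX.isHermitian) (aux_sym hRc.isHermitian.inv)
    (Matrix.nonsing_inv_mul _ hu) hF

lemma aux_res_iter {n m r : ℕ} (A X Q : Matrix (Fin n) (Fin n) ℝ) (B L : Matrix (Fin n) (Fin m) ℝ)
    (R : Matrix (Fin m) (Fin m) ℝ) (A0 : Fin r → Matrix (Fin n) (Fin n) ℝ)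
    (B0 : Fin r → Matrix (Fin n) (Fin m) ℝ)
    (hR : R.PosDef) (hX : X.PosSemidef) :
    (Ac A B L R A0 B0 X)ᵀ * X + X * Ac A B L R A0 B0 X -
        X * Gc B R B0 X * X + Hc Q L R A0 B0 X + (X - X) * Gc B R B0 X * (X - X) =
      scareRes A B Q L R A0 B0 X := by
  rw [aux_iter A X X Q B L R A0 B0 _ hR hX rfl,
    aux_res A X Q B L R A0 B0 (auxF B L R A0 B0 X) hR hX]
  simp

lemma aux_step {n m r : ℕ} (hn : 0 < n) (A Q : Matrix (Fin n) (Fin n) ℝ)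
    (B L : Matrix (Fin n) (Fin m) ℝ) (R : Matrix (Fin m) (Fin m) ℝ)
    (A0 : Fin r → Matrix (Fin n) (Fin n) ℝ) (B0 : Fin r → Matrix (Fin n) (Fin m) ℝ)
    (hR : R.PosDef) (hN : (Q - L * R⁻¹ * Lᵀ).PosSemidef)
    (hker : KernelCondition Q L R A0) (hdet : Detectable (Q - L * R⁻¹ * Lᵀ) A)
    (Xs X Y : Matrix (Fin n) (Fin n) ℝ) (hXs : Xs.PosSemidef)
    (hsol : scareRes A B Q L R A0 B0 Xs = 0) (hX : X.PosSemidef) (hY : Y.PosSemidef)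
    (hge : (X - Xs).PosSemidef) (hres : (-(scareRes A B Q L R A0 B0 X)).PosSemidef)
    (hiter : (Ac A B L R A0 B0 X)ᵀ * Y + Y * Ac A B L R A0 B0 X -
        Y * Gc B R B0 X * Y + Hc Q L R A0 B0 X + (Y - X) * Gc B R B0 X * (Y - X) = 0) :
    (X - Y).PosSemidef ∧ (Y - Xs).PosSemidef ∧ (-(scareRes A B Q L R A0 B0 Y)).PosSemidef := by
  set F := auxF B L R A0 B0 X with hF
  have e1 := aux_res A X Q B L R A0 B0 F hR hX
  rw [← hF, sub_self, Matrix.mul_zero, sub_zero] at e1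
  have e2 := aux_iter A X Y Q B L R A0 B0 F hR hX hF
  rw [hiter] at e2
  have hS : IsStableMatrix (A - B * F) := by
    refine aux_stable A (Q - L * R⁻¹ * Lᵀ) X (auxPi A0 B0 F X + -(scareRes A B Q L R A0 B0 X))
      B L R F hR hN hX ((auxPi_psd A0 B0 F X hX).add hres) (fun z hz => (hker z hz).1) hdet ?_
    rw [e1, auxW]
    abel
  have hXY : (X - Y).PosSemidef := by
    refine aux_lyap_real hn _ _ hS (hX.isHermitian.sub hY.isHermitian) ?_
    convert! hres using 1
    rw [e1, ← sub_eq_zero, e2]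
    simp only [Matrix.mul_sub, Matrix.sub_mul]
    abel
  refine ⟨hXY, ?_, ?_⟩
  · refine aux_lyap_real hn _ _ hS (hY.isHermitian.sub hXs.isHermitian) ?_
    have e3 := aux_res A Xs Q B L R A0 B0 F hR hXs
    rw [hsol] at e3
    have p1 := auxPi_psd A0 B0 F _ hge
    have p2 := aux_psd_conj (aux_Rc hR B0 hXs).posSemidef (F - auxF B L R A0 B0 Xs)
    convert! p1.add p2 using 1
    rw [auxPi_sub, ← sub_eq_zero]
    have e4 := e2.symm.trans e3
    rw [← sub_eq_zero] at e4
    rw [← neg_eq_zero, ← e4]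
    simp only [Matrix.mul_sub, Matrix.sub_mul]
    abel
  · have e3 := aux_res A Y Q B L R A0 B0 F hR hY
    have p1 := auxPi_psd A0 B0 F _ hXY
    have p2 := aux_psd_conj (aux_Rc hR B0 hY).posSemidef (F - auxF B L R A0 B0 Y)
    convert! p1.add p2 using 1
    rw [auxPi_sub, e3, ← sub_eq_zero, ← neg_eq_zero, e2]
    abel

lemma aux_inv_cont {m : ℕ} {R : Matrix (Fin m) (Fin m) ℝ} (hR : R.PosDef) :
    ContinuousAt (fun M : Matrix (Fin m) (Fin m) ℝ => M⁻¹) R := by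
  refine continuousAt_matrix_inv R ?_
  have : R.det ≠ 0 := hR.det_pos.ne'
  rw [Ring.inverse_eq_inv']
  exact continuousAt_inv₀ this

lemma aux_limit {n m r : ℕ} (A Q : Matrix (Fin n) (Fin n) ℝ)
    (B L : Matrix (Fin n) (Fin m) ℝ) (R : Matrix (Fin m) (Fin m) ℝ)
    (A0 : Fin r → Matrix (Fin n) (Fin n) ℝ) (B0 : Fin r → Matrix (Fin n) (Fin m) ℝ)
    (hR : R.PosDef) (X : ℕ → Matrix (Fin n) (Fin n) ℝ) (Y : Matrix (Fin n) (Fin n) ℝ)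
    (hY : Y.PosSemidef) (h : Tendsto X atTop (𝓝 Y))
    (hiter : ∀ k, (Ac A B L R A0 B0 (X k))ᵀ * X (k+1) +
        X (k+1) * Ac A B L R A0 B0 (X k) -
        X (k+1) * Gc B R B0 (X k) * X (k+1) + Hc Q L R A0 B0 (X k) +
        (X (k+1) - X k) * Gc B R B0 (X k) * (X (k+1) - X k) = 0) :
    scareRes A B Q L R A0 B0 Y = 0 := by
  have h' : Tendsto (fun k => X (k+1)) atTop (𝓝 Y) := h.comp (tendsto_add_atTop_nat 1)
  have c22 : Continuous (Rc R B0) := by unfold Rc Pi22; fun_prop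
  have c12 : Continuous (Lc L A0 B0) := by unfold Lc Pi12; fun_prop
  have c11 : Continuous (Qc Q A0) := by unfold Qc Pi11; fun_prop
  have tU : Tendsto (fun k => (Rc R B0 (X k))⁻¹) atTop (𝓝 (Rc R B0 Y)⁻¹) :=
    (aux_inv_cont (aux_Rc hR B0 hY)).tendsto.comp ((c22.tendsto Y).comp h)
  have tL : Tendsto (fun k => Lc L A0 B0 (X k)) atTop (𝓝 (Lc L A0 B0 Y)) := (c12.tendsto Y).comp h
  have tQ : Tendsto (fun k => Qc Q A0 (X k)) atTop (𝓝 (Qc Q A0 Y)) := (c11.tendsto Y).comp h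
  have hall := (((h.prodMk_nhds h').prodMk_nhds tU).prodMk_nhds tL).prodMk_nhds tQ
  have hc : Continuous fun p : (((Matrix (Fin n) (Fin n) ℝ × Matrix (Fin n) (Fin n) ℝ) ×
      Matrix (Fin m) (Fin m) ℝ) × Matrix (Fin n) (Fin m) ℝ) × Matrix (Fin n) (Fin n) ℝ =>
      (A - B * p.1.1.2 * p.1.2ᵀ)ᵀ * p.1.1.1.2 + p.1.1.1.2 * (A - B * p.1.1.2 * p.1.2ᵀ) -
      p.1.1.1.2 * (B * p.1.1.2 * Bᵀ) * p.1.1.1.2 + (p.2 - p.1.2 * p.1.1.2 * p.1.2ᵀ) +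
      (p.1.1.1.2 - p.1.1.1.1) * (B * p.1.1.2 * Bᵀ) * (p.1.1.1.2 - p.1.1.1.1) := by
    fun_prop
  have hlim := (hc.tendsto _).comp hall
  rw [← aux_res_iter A Y Q B L R A0 B0 hR hY]
  refine tendsto_nhds_unique hlim ?_
  refine tendsto_const_nhds.congr fun k => ?_
  exact (hiter k).symm

end helpers

/-- Monotone decreasing convergence of the modified Newton iteration. -/
theorem stmt16 (n m r : ℕ) (hn : 0 < n) (hm : 0 < m) (hr : 0 < r)
    (A Q : Matrix (Fin n) (Fin n) ℝ) (B L : Matrix (Fin n) (Fin m) ℝ)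
    (R : Matrix (Fin m) (Fin m) ℝ)
    (A0 : Fin r → Matrix (Fin n) (Fin n) ℝ) (B0 : Fin r → Matrix (Fin n) (Fin m) ℝ)
    (hQ : Q.IsHermitian) (hRsymm : R.IsHermitian)
    (hRpd : R.PosDef) (hsign : (fromBlocks Q L Lᵀ R).PosSemidef)
    (hker : KernelCondition Q L R A0)
    (hstab : Stabilizable A B)
    (hdet : Detectable (Q - L * R⁻¹ * Lᵀ) A)
    (Xs : Matrix (Fin n) (Fin n) ℝ) (hXs : Xs.PosSemidef)
    (hsol : scareRes A B Q L R A0 B0 Xs = 0)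
    (huniq : ∀ Y : Matrix (Fin n) (Fin n) ℝ, Y.PosSemidef →
      scareRes A B Q L R A0 B0 Y = 0 → Y = Xs)
    (X : ℕ → Matrix (Fin n) (Fin n) ℝ)
    (hsymm : ∀ k, (X k).IsHermitian)
    (h0ge : (X 0 - Xs).PosSemidef)
    (h0stab : IsStableMatrix (Ac A B L R A0 B0 (X 0) - Gc B R B0 (X 0) * X 0))
    (h0res : (-(scareRes A B Q L R A0 B0 (X 0))).PosSemidef)
    (hiter : ∀ k, (Ac A B L R A0 B0 (X k))ᵀ * X (k+1) +
        X (k+1) * Ac A B L R A0 B0 (X k) -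
        X (k+1) * Gc B R B0 (X k) * X (k+1) + Hc Q L R A0 B0 (X k) +
        (X (k+1) - X k) * Gc B R B0 (X k) * (X (k+1) - X k) = 0)
    (hpsd : ∀ k, (X k).PosSemidef) :
    (∀ k, (X k - X (k+1)).PosSemidef ∧ (X (k+1) - Xs).PosSemidef ∧
        (-(scareRes A B Q L R A0 B0 (X k))).PosSemidef) ∧
      Tendsto X atTop (nhds Xs) := by
  have hN : (Q - L * R⁻¹ * Lᵀ).PosSemidef := by
    have := hRpd.isUnit.invertible
    rw [← Matrix.conjTranspose_eq_transpose_of_trivial] at hsign ⊢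
    exact (hRpd.fromBlocks₂₂ Q L).1 hsign
  have hstep := fun k => aux_step hn A Q B L R A0 B0 hRpd hN hker hdet Xs (X k) (X (k+1)) hXs hsol
    (hpsd k) (hpsd (k+1))
  have hall : ∀ k, (X k - Xs).PosSemidef ∧ (-(scareRes A B Q L R A0 B0 (X k))).PosSemidef := by
    intro k
    induction k with
    | zero => exact ⟨h0ge, h0res⟩
    | succ k ih => exact (hstep k ih.1 ih.2 (hiter k)).2
  have hmono : ∀ k, (X k - X (k+1)).PosSemidef := fun k =>
    (hstep k (hall k).1 (hall k).2 (hiter k)).1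
  refine ⟨fun k => ⟨hmono k, (hall (k+1)).1, (hall k).2⟩, ?_⟩
  obtain ⟨Y, hY⟩ := aux_monotone X hpsd hmono
  have hYp := aux_psd_closed X Y hpsd hY
  rw [← huniq Y hYp (aux_limit A Q B L R A0 B0 hRpd X Y hYp hY hiter)]
  exact hY
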